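/- With the standing setup (prime p, l_p, B, Ψ_B, 𝒵_B, b_max, θ_max, θ_min, A_1(B), A_2(B), P_B, I, odd s, n ∈ I, the rational function R_n and its partial fraction coefficients r_{i,k}, and d_n = lcm(1,…,n)), define for θ ∈ 𝒵_B the rational number ρ_{0,θ} = −Σ_{i=1}^{s} Σ_{k=1}^{n} Σ_{ν=0}^{k−1} r_{i,k}/(ν+θ)^i. Then for every θ_0 ∈ 𝒵_B ∖ {θ_min}, the rational number d_n^{s} · ρ_{0,θ_0} is an integer. -/

import Mathlib

/-- The integer `l_p`: `1` if `p ≥ 5`, `2` if `p = 3`, `3` if `p = 2`. -/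
def ellp (p : ℕ) : ℕ := if 5 ≤ p then 1 else if p = 3 then 2 else 3

/-- `d_n = lcm(1, 2, …, n)`. -/
def dd (n : ℕ) : ℕ := (Finset.Icc 1 n).lcm id

/-- The rational function
`R_n(t) = A₁(B)^n A₂(B)^n (n!^{s-|𝒵|+1}/(θ_max n - 1)!) (t+θ_max)_{θ_max n-1}
  ∏_{θ ∈ 𝒵∖{θ_max}} (t+θ)_n / ((t)_{n+1})^s`,
where `Ψ = Ψ_B`, `Z = 𝒵_B`, `θ_max = (p^{l_p} b_max - 1)/(p^{l_p} b_max)` and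
Pochhammer symbols are written as products. -/
noncomputable def Rfun (p : ℕ) (Ψ : Finset ℕ) (Z : Finset ℚ) (bmax s n : ℕ) (t : ℚ) : ℚ :=
  let Nb : ℕ := p ^ ellp p * bmax
  let m : ℕ := (Nb - 1) * n / Nb
  let θmax : ℚ := ((Nb : ℚ) - 1) / (Nb : ℚ)
  let A1 : ℕ := ∏ b ∈ Ψ, (p ^ ellp p * b) ^ (p ^ ellp p * b).totient
  let A2 : ℕ := ∏ b ∈ Ψ, ∏ q ∈ (p ^ ellp p * b).primeFactors,
    q ^ ((p ^ ellp p * b).totient / (q - 1))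
  (A1 : ℚ) ^ n * (A2 : ℚ) ^ n *
    ((Nat.factorial n : ℚ) ^ (s - Z.card + 1) / (Nat.factorial (m - 1) : ℚ)) *
    (∏ j ∈ Finset.range (m - 1), (t + θmax + (j : ℚ))) *
    (∏ θ ∈ Z.erase θmax, ∏ j ∈ Finset.range n, (t + θ + (j : ℚ))) /
    (∏ j ∈ Finset.range (n + 1), (t + (j : ℚ))) ^ s


section aux
open Polynomial

lemma prodDesc {R : Type*} [CommRing R] (x : R) (r : ℕ) :
    (descPochhammer ℤ r).smeval x = ∏ j ∈ Finset.range r, (x - (j : R)) := by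
  induction r with
  | zero => simp
  | succ r ih =>
    rw [descPochhammer_succ_right, smeval_mul, ih, Finset.prod_range_succ]
    simp [smeval_sub, smeval_natCast]

lemma fact_dvd_prod (a : ℤ) (r : ℕ) :
    (r.factorial : ℤ) ∣ ∏ j ∈ Finset.range r, (a - (j : ℤ)) := by
  rw [← prodDesc, Ring.descPochhammer_eq_factorial_smul_choose]
  exact ⟨Ring.choose a r, by simp⟩

/-- binomial polynomial -/
noncomputable def bp (x : ℚ[X]) (r : ℕ) : ℚ[X] :=
  C (1 / (r.factorial : ℚ)) * ∏ j ∈ Finset.range r, (x - (j : ℚ[X]))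

lemma bp_eq (x : ℚ[X]) (r : ℕ) : bp x r = Ring.choose x r := by
  rw [bp, ← prodDesc, Ring.descPochhammer_eq_factorial_smul_choose, nsmul_eq_mul, ← mul_assoc,
    ← C_eq_natCast, ← C_mul, one_div_mul_cancel (by positivity)]
  simp

lemma bp_add (x y : ℚ[X]) (r : ℕ) :
    bp (x + y) r = ∑ ij ∈ Finset.HasAntidiagonal.antidiagonal r, bp x ij.1 * bp y ij.2 := by
  simp only [bp_eq]
  exact Ring.add_choose_eq r (Commute.all x y)

/-- the multiplier -/
def MM (N r : ℕ) : ℕ := ∏ q ∈ N.primeFactors, q ^ (r / (q - 1))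

lemma MM_dvd {N r n : ℕ} (h : r ≤ n) : MM N r ∣ MM N n := by
  apply Finset.prod_dvd_prod_of_dvd
  intro q _
  exact pow_dvd_pow _ (Nat.div_le_div_right h)

lemma key_dvd (N : ℕ) (hN : N ≠ 0) (a : ℤ) (r : ℕ) :
    (r.factorial : ℤ) ∣ (MM N r : ℤ) * ∏ j ∈ Finset.range r, (a - (j : ℤ) * N) := by
  rw [← Int.natAbs_dvd_natAbs, Int.natAbs_natCast, Nat.dvd_iff_prime_pow_dvd_dvd]
  intro q k hq hk
  rw [← Int.natCast_dvd]
  by_cases hqN : q ∣ N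
  · apply Dvd.dvd.mul_right
    norm_cast
    have h1 : q ^ (r / (q - 1)) ∣ MM N r :=
      Finset.dvd_prod_of_mem (fun q => q ^ (r / (q - 1))) (by simp [hq, hqN, hN])
    refine (pow_dvd_pow q ?_).trans h1
    have := Fact.mk hq
    have h2 := sub_one_mul_padicValNat_factorial (p := q) r
    have h3 : k ≤ padicValNat q r.factorial :=
      (padicValNat_dvd_iff_le (Nat.factorial_ne_zero r)).1 hk
    rw [Nat.le_div_iff_mul_le (by have := hq.two_le; omega)]
    calc k * (q - 1) ≤ (q - 1) * padicValNat q r.factorial := by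
          rw [mul_comm]; exact Nat.mul_le_mul_left _ h3
      _ ≤ r := by rw [h2]; omega
  · apply Dvd.dvd.mul_left
    have hcop : IsCoprime (N : ℤ) ((q ^ k : ℕ) : ℤ) := by
      rw [Nat.isCoprime_iff_coprime]
      exact Nat.Coprime.pow_right _ ((Nat.Prime.coprime_iff_not_dvd hq).2 hqN).symm
    obtain ⟨u, v, huv⟩ := hcop
    have hu : IsCoprime ((q ^ k : ℕ) : ℤ) (u ^ r) := by
      apply IsCoprime.pow_right
      exact ⟨v, N, by linarith⟩
    refine hu.dvd_of_dvd_mul_left (?_ : _ ∣ u ^ r * _)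
    have h1 : u ^ r * ∏ j ∈ Finset.range r, (a - (j : ℤ) * N) =
      ∏ j ∈ Finset.range r, (u * (a - (j : ℤ) * N)) := by
      rw [Finset.prod_mul_distrib]; simp
    rw [h1]
    have h2 : (∏ j ∈ Finset.range r, (u * (a - (j : ℤ) * N))) ≡
        ∏ j ∈ Finset.range r, (u * a - (j : ℤ)) [ZMOD ((q ^ k : ℕ) : ℤ)] := by
      apply Int.ModEq.prod
      intro j _
      rw [Int.modEq_iff_dvd]
      refine ⟨- v * j, ?_⟩
      linear_combination (j : ℤ) * huv
    rw [Int.ModEq.dvd_iff h2]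
    exact (Int.natCast_dvd_natCast.2 hk).trans (fact_dvd_prod _ _)

/-- polynomials with integer coefficients -/
noncomputable abbrev LL : Subsemiring ℚ[X] := lifts (Int.castRingHom ℚ)

lemma C_int_mem {x : ℚ} (h : ∃ z : ℤ, x = z) : C x ∈ LL := by
  obtain ⟨z, rfl⟩ := h
  exact C'_mem_lifts ⟨z, by simp⟩

lemma dvd_dd {n j : ℕ} (h1 : 1 ≤ j) (h2 : j ≤ n) : j ∣ dd n :=
  Finset.dvd_lcm (f := id) (by simp [h1, h2])

lemma dd_ne (n : ℕ) : dd n ≠ 0 := by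
  unfold dd
  rw [Ne, Finset.lcm_eq_zero_iff]
  simp

lemma dd_div_int {n j : ℕ} (h1 : 1 ≤ j) (h2 : j ≤ n) : ∃ z : ℤ, (dd n : ℚ) / j = z := by
  obtain ⟨c, hc⟩ := dvd_dd h1 h2
  have : (j : ℚ) ≠ 0 := by positivity
  exact ⟨c, by rw [hc]; push_cast; field_simp⟩

lemma bp_dX_aux {n i : ℕ} (hi : i ≤ n) :
    C (1 / (i.factorial : ℚ)) *
      ∏ j ∈ Finset.range i, (C (dd n : ℚ) * X - ((j + 1 : ℕ) : ℚ[X])) ∈ LL := by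
  induction i with
  | zero => simp [LL]
  | succ i ih =>
    have h := ih (by omega)
    have h2 : C ((dd n : ℚ) / ((i + 1 : ℕ) : ℚ)) * X + C (-1) ∈ LL :=
      add_mem (mul_mem (C_int_mem (dd_div_int (by omega) hi)) (X_mem_lifts _))
        (C_int_mem ⟨-1, by simp⟩)
    have h3 := mul_mem h h2
    convert h3 using 1
    rw [Finset.prod_range_succ, Nat.factorial_succ]
    have e1 : (1 / (((i + 1) * i.factorial : ℕ) : ℚ)) = 1 / (i.factorial : ℚ) * (1 / ((i + 1 : ℕ) : ℚ)) := by
      push_cast; field_simp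
    have e2 : C ((dd n : ℚ) / ((i + 1 : ℕ) : ℚ)) * X + C (-1) =
        C (1 / ((i + 1 : ℕ) : ℚ)) * (C (dd n : ℚ) * X - ((i + 1 : ℕ) : ℚ[X])) := by
      rw [← C_eq_natCast, mul_sub, ← mul_assoc, ← C_mul, ← C_mul,
        one_div_mul_cancel (by positivity), one_div_mul_eq_div]
      simp [sub_eq_add_neg]
    rw [e1, e2, C_mul]; ring

lemma bp_dX {n i : ℕ} (hi : i ≤ n) : bp (C (dd n : ℚ) * X) i ∈ LL := by
  cases i with
  | zero => simp [bp, LL]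
  | succ i =>
    have h := bp_dX_aux (n := n) (i := i) (by omega)
    have h2 : C ((dd n : ℚ) / ((i + 1 : ℕ) : ℚ)) * X ∈ LL :=
      (mul_mem (C_int_mem (dd_div_int (by omega) hi)) (X_mem_lifts _))
    have h3 := mul_mem h h2
    convert h3 using 1
    rw [bp, Finset.prod_range_succ', Nat.factorial_succ]
    have e1 : (1 / (((i + 1) * i.factorial : ℕ) : ℚ)) = 1 / (i.factorial : ℚ) * (1 / ((i + 1 : ℕ) : ℚ)) := by
      push_cast; field_simp
    have e2 : C ((dd n : ℚ) / ((i + 1 : ℕ) : ℚ)) * X =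
        C (1 / ((i + 1 : ℕ) : ℚ)) * (C (dd n : ℚ) * X) := by
      rw [← mul_assoc, ← C_mul, one_div_mul_eq_div]
    rw [e1, e2, C_mul, Nat.cast_zero, sub_zero]; ring

lemma bp_const {N n j : ℕ} (hN : N ≠ 0) (a : ℤ) (hj : j ≤ n) :
    C ((N : ℚ) ^ n * (MM N n : ℚ)) * bp (C ((a : ℚ) / N)) j ∈ LL := by
  have e : bp (C ((a : ℚ) / N)) j =
      C (1 / (j.factorial : ℚ) * ∏ i ∈ Finset.range j, ((a : ℚ) / N - i)) := by
    rw [bp, C_mul, map_prod]; simp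
  rw [e, ← C_mul]
  apply C_int_mem
  obtain ⟨c, hc⟩ := key_dvd N hN a j
  obtain ⟨w, hw⟩ := MM_dvd (N := N) hj
  refine ⟨N ^ (n - j) * w * c, ?_⟩
  have hN' : (N : ℚ) ≠ 0 := by exact_mod_cast hN
  have hp : (N : ℚ) ^ j * ∏ i ∈ Finset.range j, ((a : ℚ) / N - i) =
      ∏ i ∈ Finset.range j, ((a : ℚ) - i * N) := by
    rw [← Finset.card_range j, ← Finset.prod_const, Finset.card_range, ← Finset.prod_mul_distrib]
    apply Finset.prod_congr rfl
    intro i _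
    field_simp
  have hc' : (MM N j : ℚ) * ∏ i ∈ Finset.range j, ((a : ℚ) - i * N) = j.factorial * c := by
    exact_mod_cast hc
  have hpow : (N : ℚ) ^ n = N ^ (n - j) * N ^ j := by rw [← pow_add]; congr 1; omega
  rw [hw, hpow]
  push_cast
  rw [← hp] at hc'
  have hf : (j.factorial : ℚ) ≠ 0 := by positivity
  generalize (∏ i ∈ Finset.range j, ((a : ℚ) / N - i)) = P at hc' ⊢
  field_simp
  linear_combination w * hc'

lemma bp_block {N n r : ℕ} (hN : N ≠ 0) (a : ℤ) (hr : r ≤ n) :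
    C ((N : ℚ) ^ n * (MM N n : ℚ)) * bp (C (dd n : ℚ) * X + C ((a : ℚ) / N)) r ∈ LL := by
  rw [bp_add, Finset.mul_sum]
  apply sum_mem
  rintro ⟨i, j⟩ hij
  rw [Finset.HasAntidiagonal.mem_antidiagonal] at hij
  simp only at hij ⊢
  rw [mul_left_comm]
  exact mul_mem (bp_dX (by omega)) (bp_const hN a (by omega))

lemma asc_block {N n r : ℕ} (hN : N ≠ 0) (a : ℤ) (k : ℕ) (hr : r ≤ n) :
    C ((N : ℚ) ^ n * (MM N n : ℚ)) * (C (1 / (r.factorial : ℚ)) *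
      ∏ j ∈ Finset.range r, (C (dd n : ℚ) * X + C ((a : ℚ) / N - k + j))) ∈ LL := by
  have h := bp_block hN (a - k * N + (r - 1) * N) hr
  convert h using 2
  rw [bp, ← Finset.prod_range_reflect]
  congr 1
  apply Finset.prod_congr rfl
  intro j hj
  rw [Finset.mem_range] at hj
  rw [add_sub_assoc, ← C_eq_natCast, ← C_sub]
  congr 2
  have hN' : (N : ℚ) ≠ 0 := by exact_mod_cast hN
  have : ((r - 1 - j : ℕ) : ℚ) = r - 1 - j := by
    rw [Nat.sub_sub, Nat.cast_sub (by omega)]; push_cast; ring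
  rw [this]; push_cast
  field_simp
  ring

lemma coef_int {H G T Q : ℚ[X]} {s : ℕ} (hH : H ∈ LL) (hH0 : H.coeff 0 = 1) (hG : G ∈ LL)
    (h : G = H * T + X ^ s * Q) : ∀ j < s, ∃ z : ℤ, T.coeff j = z := by
  intro j
  induction j using Nat.strong_induction_on with
  | _ j ih =>
  intro hj
  have hH' := (lifts_iff_coeff_lifts H).1 hH
  obtain ⟨g, hg⟩ := (lifts_iff_coeff_lifts G).1 hG j
  have h1 : G.coeff j = (∑ a ∈ Finset.range j, T.coeff a * H.coeff (j - a)) + T.coeff j := by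
    rw [h, coeff_add, coeff_X_pow_mul', if_neg (by omega), mul_comm, coeff_mul,
      Finset.Nat.sum_antidiagonal_eq_sum_range_succ_mk, Finset.sum_range_succ]
    simp [hH0]
  have h2 : ∃ z : ℤ, (∑ a ∈ Finset.range j, T.coeff a * H.coeff (j - a)) = z := by
    have : (∑ a ∈ Finset.range j, T.coeff a * H.coeff (j - a)) ∈ (Int.castRingHom ℚ).range := by
      apply sum_mem
      intro a ha
      rw [Finset.mem_range] at ha
      apply mul_mem
      · obtain ⟨z, hz⟩ := ih a ha (by omega)
        exact ⟨z, by simp [hz]⟩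
      · obtain ⟨z, hz⟩ := hH' (j - a)
        exact ⟨z, hz⟩
    obtain ⟨z, hz⟩ := this
    exact ⟨z, by simpa using hz.symm⟩
  obtain ⟨z, hz⟩ := h2
  refine ⟨g - z, ?_⟩
  rw [hz, ← hg] at h1
  push_cast
  simp at h1
  linarith

lemma prod_erase_split (n k : ℕ) (hk : k ≤ n) :
    ∏ j ∈ (Finset.range (n + 1)).erase k, ((j : ℚ) - k) =
      (-1) ^ k * k.factorial * (n - k).factorial := by
  have h1 : (Finset.range (n + 1)).erase k = Finset.range k ∪ Finset.Ico (k + 1) (n + 1) := by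
    ext j; simp; omega
  rw [h1, Finset.prod_union, Finset.prod_Ico_eq_prod_range]
  · congr 1
    · rw [← Finset.prod_range_reflect]
      have : ∀ j ∈ Finset.range k, (((k - 1 - j : ℕ) : ℚ) - k) = (-1) * ((j + 1 : ℕ) : ℚ) := by
        intro j hj
        rw [Finset.mem_range] at hj
        rw [Nat.sub_sub, Nat.cast_sub (by omega)]; push_cast; ring
      rw [Finset.prod_congr rfl this, Finset.prod_mul_distrib, ← Nat.cast_prod,
        Finset.prod_range_add_one_eq_factorial]
      simp
    · rw [← Finset.prod_range_add_one_eq_factorial, Nat.cast_prod]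
      apply Finset.prod_congr (by congr 1; omega)
      intro j _
      push_cast; ring
  · rw [Finset.disjoint_left]; intro j; simp; omega

lemma c_int (n k : ℕ) (hk : k ≤ n) :
    ∃ z : ℤ, (n.factorial : ℚ) / ∏ j ∈ (Finset.range (n + 1)).erase k, ((j : ℚ) - k) = z := by
  rw [prod_erase_split n k hk]
  refine ⟨(-1) ^ k * n.choose k, ?_⟩
  rw [← Nat.choose_mul_factorial_mul_factorial hk]
  push_cast
  rcases neg_one_pow_eq_or ℚ k with h | h <;> rw [h] <;> field_simp

lemma u_int {n k j : ℕ} (hk : k ≤ n) (hj : j ≤ n) (hjk : j ≠ k) :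
    ∃ z : ℤ, (dd n : ℚ) / ((j : ℚ) - k) = z := by
  rcases lt_or_gt_of_ne hjk with h | h
  · obtain ⟨z, hz⟩ := dd_div_int (n := n) (j := k - j) (by omega) (by omega)
    refine ⟨-z, ?_⟩
    push_cast
    rw [← hz, Nat.cast_sub h.le, ← div_neg, neg_sub]
  · obtain ⟨z, hz⟩ := dd_div_int (n := n) (j := j - k) (by omega) (by omega)
    refine ⟨z, ?_⟩
    rw [← hz, Nat.cast_sub h.le]

lemma partial_int (n s : ℕ) (F : ℚ[X]) (r : ℕ → ℕ → ℚ) (k0 : ℕ) (hk0 : k0 ≤ n)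
    (hF : ∀ t : ℚ, (∀ j ∈ Finset.range (n + 1), t + (j : ℚ) ≠ 0) →
      (n.factorial : ℚ) ^ s * F.eval t / (∏ j ∈ Finset.range (n + 1), (t + (j : ℚ))) ^ s =
        ∑ i ∈ Finset.Icc 1 s, ∑ k ∈ Finset.range (n + 1), r i k / (t + (k : ℚ)) ^ i)
    (hG : F.comp (C (dd n : ℚ) * X - C (k0 : ℚ)) ∈ LL) :
    ∀ i ∈ Finset.Icc 1 s, ∃ z : ℤ, (dd n : ℚ) ^ (s - i) * r i k0 = z := by
  set d : ℚ := (dd n : ℚ) with hd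
  have hd1 : (1 : ℚ) ≤ d := by
    have := Nat.one_le_iff_ne_zero.2 (dd_ne n)
    rw [hd]; exact_mod_cast this
  set E := (Finset.range (n + 1)).erase k0 with hE
  set c : ℚ := (n.factorial : ℚ) / ∏ j ∈ E, ((j : ℚ) - k0) with hc
  have hEk : ∀ j ∈ E, ((j : ℚ) - k0) ≠ 0 := by
    intro j hj
    rw [hE, Finset.mem_erase] at hj
    rw [sub_ne_zero]; exact_mod_cast hj.1
  let V : Finset ℕ → ℚ[X] := fun S => ∏ j ∈ S, (1 + C (d / ((j : ℚ) - k0)) * X)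
  have hVL : V E ∈ LL := by
    apply prod_mem
    intro j hj
    rw [hE, Finset.mem_erase, Finset.mem_range] at hj
    exact add_mem (one_mem _) (mul_mem (C_int_mem (u_int hk0 (by omega) hj.1)) (X_mem_lifts _))
  let T : ℚ[X] := ∑ i ∈ Finset.Icc 1 s, C (d ^ (s - i) * r i k0) * X ^ (s - i)
  let Q : ℚ[X] := ∑ i ∈ Finset.Icc 1 s, ∑ k ∈ E,
    C (r i k * d ^ s / ((k : ℚ) - k0) ^ i) * (V E ^ (s - i) * V (E.erase k) ^ i)
  have main : C (c ^ s) * F.comp (C d * X - C (k0 : ℚ)) = V E ^ s * T + X ^ s * Q := by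
    apply eq_of_infinite_eval_eq
    have hinf : (Set.range (fun m : ℕ => ((m + n + 1 : ℕ) : ℚ))).Infinite := by
      apply Set.infinite_range_of_injective
      intro a b hab
      simp at hab; exact hab
    refine hinf.mono ?_
    rintro _ ⟨m, rfl⟩
    simp only [Set.mem_ofPred_eq]
    set x : ℚ := ((m + n + 1 : ℕ) : ℚ) with hx
    have hxn : (n : ℚ) + 1 ≤ x := by rw [hx]; push_cast; linarith [(Nat.cast_nonneg m : (0:ℚ) ≤ m)]
    have hn0 : (0 : ℚ) ≤ n := Nat.cast_nonneg n
    have hdx : (n : ℚ) + 1 ≤ d * x := by nlinarith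
    have hk0' : (k0 : ℚ) ≤ n := by exact_mod_cast hk0
    have ht : ∀ j ∈ Finset.range (n + 1), (d * x - k0) + (j : ℚ) ≠ 0 := by
      intro j _
      have : (0 : ℚ) ≤ j := Nat.cast_nonneg j
      have : 0 < (d * x - k0) + (j : ℚ) := by linarith
      exact this.ne'
    have hdx0 : d * x ≠ 0 := by linarith
    have hx0 : x ≠ 0 := by linarith
    have hd0 : d ≠ 0 := by linarith
    have key := hF _ ht
    have hfac : ∀ j ∈ E, (d * x - k0) + (j : ℚ) =
        ((j : ℚ) - k0) * (1 + d / ((j : ℚ) - k0) * x) := by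
      intro j hj
      have := hEk j hj
      field_simp; ring
    have hfac0 : ∀ j ∈ E, (1 + d / ((j : ℚ) - k0) * x) ≠ 0 := by
      intro j hj h0
      apply ht j (Finset.mem_of_mem_erase hj)
      rw [hfac j hj, h0, mul_zero]
    have hVe : ∀ S, (V S).eval x = ∏ j ∈ S, (1 + d / ((j : ℚ) - k0) * x) := by
      intro S
      simp [V, eval_prod]
    have hk0mem : k0 ∈ Finset.range (n + 1) := by simp; omega
    have hprod : ∏ j ∈ Finset.range (n + 1), ((d * x - k0) + (j : ℚ)) =
        d * x * ((∏ j ∈ E, ((j : ℚ) - k0)) * (V E).eval x) := by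
      rw [← Finset.mul_prod_erase _ _ hk0mem, sub_add_cancel, Finset.prod_congr rfl hfac,
        Finset.prod_mul_distrib, hVe]
    have hW0 : ∏ j ∈ E, ((j : ℚ) - k0) ≠ 0 := Finset.prod_ne_zero_iff.2 hEk
    have hv0 : (V E).eval x ≠ 0 := by rw [hVe]; exact Finset.prod_ne_zero_iff.2 hfac0
    rw [hprod] at key
    have key2 : c ^ s * F.eval (d * x - k0) = (d * x * (V E).eval x) ^ s *
        ∑ i ∈ Finset.Icc 1 s, ∑ k ∈ Finset.range (n + 1), r i k / ((d * x - k0) + (k : ℚ)) ^ i := by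
      rw [← key, hc]
      generalize (∏ j ∈ E, ((j : ℚ) - k0)) = W at hW0 ⊢
      rw [div_pow]
      simp only [mul_pow]
      field_simp
    simp only [eval_mul, eval_add, eval_C, eval_comp, eval_sub, eval_X, eval_pow]
    rw [key2]
    simp only [T, Q, eval_finsetSum, eval_mul, eval_C, eval_pow, eval_X, Finset.mul_sum]
    rw [← Finset.sum_add_distrib]
    apply Finset.sum_congr rfl
    intro i hi
    rw [Finset.mem_Icc] at hi
    rw [← Finset.add_sum_erase _ _ hk0mem]
    have hsi : ∀ y : ℚ, y ^ s = y ^ (s - i) * y ^ i := by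
      intro y; rw [← pow_add]; congr 1; omega
    congr 1
    · rw [sub_add_cancel, mul_pow, hsi (d * x), mul_pow d x (s - i)]
      field_simp
    · apply Finset.sum_congr rfl
      intro k hk
      rw [← hE] at hk
      have hvk : (V E).eval x = (1 + d / ((k : ℚ) - k0) * x) * (V (E.erase k)).eval x := by
        rw [hVe, hVe]
        exact (Finset.mul_prod_erase E (fun j : ℕ => 1 + d / ((j : ℚ) - k0) * x) hk).symm
      have h1 := hfac0 k hk
      have h2 := hEk k hk
      rw [hfac k hk, mul_pow _ ((V E).eval x), hsi ((V E).eval x)]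
      have h3 : (V E).eval x ^ i = (1 + d / ((k : ℚ) - k0) * x) ^ i * (V (E.erase k)).eval x ^ i := by
        rw [hvk, mul_pow]
      rw [h3]
      generalize (1 + d / ((k : ℚ) - k0) * x) = y at h1 ⊢
      rw [mul_pow, mul_pow]
      field_simp
  have hcint : ∃ z : ℤ, c ^ s = z := by
    obtain ⟨z, hz⟩ := c_int n k0 hk0
    exact ⟨z ^ s, by rw [hc, hz]; simp⟩
  have hV0 : (V E ^ s).coeff 0 = 1 := by
    rw [coeff_zero_eq_eval_zero]
    simp [V, eval_prod]
  have hfin := coef_int (pow_mem hVL s) hV0 (mul_mem (C_int_mem hcint) hG) main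
  intro i hi
  have hi' := hi
  rw [Finset.mem_Icc] at hi
  obtain ⟨z, hz⟩ := hfin (s - i) (by omega)
  refine ⟨z, ?_⟩
  rw [← hz]
  simp only [T, finsetSum_coeff, coeff_C_mul, coeff_X_pow]
  rw [Finset.sum_eq_single i]
  · simp
  · intro b hb hbi
    rw [Finset.mem_Icc] at hb
    rw [if_neg (by omega), mul_zero]
  · intro h; exact absurd hi' h

lemma int_of_padic (x : ℚ) (h : ∀ q : ℕ, q.Prime → padicNorm q x ≤ 1) : ∃ z : ℤ, x = z := by
  by_cases hx : x.den = 1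
  · exact ⟨x.num, (Rat.den_eq_one_iff x).1 hx |>.symm⟩
  · exfalso
    obtain ⟨q, hq, hqd⟩ := Nat.exists_prime_and_dvd hx
    have := Fact.mk hq
    have h1 := h q hq
    rw [← Rat.num_div_den x, padicNorm.div] at h1
    have h2 : padicNorm q (x.num : ℚ) = 1 := by
      rw [padicNorm.int_eq_one_iff]
      intro h3
      have h4 : q ∣ x.num.natAbs := Int.natCast_dvd.1 h3
      have h5 := Nat.dvd_gcd h4 hqd
      rw [x.reduced] at h5
      exact hq.one_lt.ne' (Nat.dvd_one.1 h5)
    have h3 : padicNorm q (x.den : ℚ) < 1 := (padicNorm.nat_lt_one_iff x.den).2 hqd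
    have h4 : 0 < padicNorm q (x.den : ℚ) :=
      lt_of_le_of_ne (padicNorm.nonneg _) (padicNorm.nonzero (by exact_mod_cast x.den_nz)).symm
    rw [h2, div_le_one h4] at h1
    linarith

lemma term_le {q : ℕ} [Fact q.Prime] {d x ρ : ℚ} {s i : ℕ} (hi : i ≤ s) (hd : d ≠ 0)
    (hx : padicNorm q d ≤ padicNorm q x) (hρ : ∃ z : ℤ, d ^ (s - i) * ρ = z) :
    padicNorm q (d ^ s * (ρ / x ^ i)) ≤ 1 := by
  have hd0 : 0 < padicNorm q d := lt_of_le_of_ne (padicNorm.nonneg _) (padicNorm.nonzero hd).symm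
  have e : d ^ s * (ρ / x ^ i) = (d ^ (s - i) * ρ) * (d / x) ^ i := by
    have : d ^ s = d ^ (s - i) * d ^ i := by rw [← pow_add]; congr 1; omega
    rw [this, div_pow]; ring
  obtain ⟨z, hz⟩ := hρ
  rw [e, hz, padicNorm.mul, IsAbsoluteValue.abv_pow (padicNorm q), padicNorm.div]
  have h1 : padicNorm q d / padicNorm q x ≤ 1 := by
    rw [div_le_one (by linarith)]; exact hx
  have h2 : 0 ≤ padicNorm q d / padicNorm q x := div_nonneg (padicNorm.nonneg _) (padicNorm.nonneg _)
  exact mul_le_one₀ (padicNorm.of_int z) (pow_nonneg h2 i) (pow_le_one₀ h2 h1)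

lemma slice_int (n s : ℕ) (r : ℕ → ℕ → ℚ) (θ : ℚ)
    (hr : ∀ i ∈ Finset.Icc 1 s, ∀ k ≤ n, ∃ z : ℤ, (dd n : ℚ) ^ (s - i) * r i k = z)
    (l : ℕ)
    (hzero : ∑ i ∈ Finset.Icc 1 s, ∑ k ∈ Finset.range (n + 1), r i k / (θ - l + k) ^ i = 0) :
    ∃ z : ℤ, (dd n : ℚ) ^ s *
      ∑ i ∈ Finset.Icc 1 s, ∑ k ∈ Finset.Icc l n, r i k / (θ - l + k) ^ i = z := by
  apply int_of_padic
  intro q hq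
  have := Fact.mk hq
  have hd : (dd n : ℚ) ≠ 0 := by exact_mod_cast dd_ne n
  have gen : ∀ S : Finset ℕ, (∀ k ∈ S, k ≤ n ∧ padicNorm q (dd n : ℚ) ≤ padicNorm q (θ - l + k)) →
      padicNorm q ((dd n : ℚ) ^ s *
        ∑ i ∈ Finset.Icc 1 s, ∑ k ∈ S, r i k / (θ - l + k) ^ i) ≤ 1 := by
    intro S hS
    simp only [Finset.mul_sum]
    refine padicNorm.sum_le' (fun i hi => padicNorm.sum_le' (fun k hk => ?_) zero_le_one) zero_le_one
    exact term_le (Finset.mem_Icc.1 hi).2 hd (hS k hk).2 (hr i hi k (hS k hk).1)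
  by_cases hall : ∀ k ∈ Finset.Icc l n, padicNorm q (dd n : ℚ) ≤ padicNorm q (θ - l + k)
  · exact gen _ (fun k hk => ⟨(Finset.mem_Icc.1 hk).2, hall k hk⟩)
  · push Not at hall
    obtain ⟨k1, hk1, hlt⟩ := hall
    rw [Finset.mem_Icc] at hk1
    have hsplit : ∑ i ∈ Finset.Icc 1 s, ∑ k ∈ Finset.Icc l n, r i k / (θ - l + k) ^ i =
        - ∑ i ∈ Finset.Icc 1 s, ∑ k ∈ Finset.range l, r i k / (θ - l + k) ^ i := by
      rw [eq_neg_iff_add_eq_zero, ← hzero, ← Finset.sum_add_distrib]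
      apply Finset.sum_congr rfl
      intro i _
      have hU : Finset.range (n + 1) = Finset.Icc l n ∪ Finset.range l := by
        ext j; simp; omega
      rw [hU, Finset.sum_union]
      rw [Finset.disjoint_left]; intro j; simp; omega
    rw [hsplit, mul_neg, padicNorm.neg]
    apply gen
    intro k hk
    rw [Finset.mem_range] at hk
    refine ⟨by omega, ?_⟩
    obtain ⟨c, hc⟩ := dvd_dd (n := n) (j := k1 - k) (by omega) (by omega)
    have h1 : padicNorm q (dd n : ℚ) ≤ padicNorm q ((k1 - k : ℕ) : ℚ) := by
      rw [hc, Nat.cast_mul, padicNorm.mul]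
      exact mul_le_of_le_one_right (padicNorm.nonneg _) (padicNorm.of_nat c)
    have h2 : ((k1 - k : ℕ) : ℚ) = (θ - l + k1) - (θ - l + k) := by
      rw [Nat.cast_sub (by omega)]; ring
    rw [h2] at h1
    have h3 := h1.trans (padicNorm.sub (p := q))
    rcases le_max_iff.1 h3 with h | h
    · linarith
    · exact h

lemma sum_reindex (n : ℕ) (f : ℕ → ℕ → ℚ) :
    ∑ k ∈ Finset.Icc 1 n, ∑ ν ∈ Finset.range k, f k ν =
      ∑ l ∈ Finset.Icc 1 n, ∑ k ∈ Finset.Icc l n, f k (k - l) := by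
  have h1 : ∀ k ∈ Finset.Icc 1 n, ∑ ν ∈ Finset.range k, f k ν = ∑ l ∈ Finset.Icc 1 k, f k (k - l) := by
    intro k _
    refine Finset.sum_bij' (fun ν _ => k - ν) (fun l _ => k - l) ?_ ?_ ?_ ?_ ?_
    · intro a ha; simp at ha ⊢; omega
    · intro a ha; simp at ha ⊢; omega
    · intro a ha; simp at ha ⊢; omega
    · intro a ha; simp at ha ⊢; omega
    · intro a ha
      simp only [Finset.mem_range] at ha
      congr 1; omega
  rw [Finset.sum_congr rfl h1]
  apply Finset.sum_comm'
  intro x y; simp; omega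

lemma A_dvd_one (N n : ℕ) :
    (N ^ n * MM N n) ^ N.totient ∣
      (N ^ N.totient) ^ n * (∏ q ∈ N.primeFactors, q ^ (N.totient / (q - 1))) ^ n := by
  rw [mul_pow, ← pow_mul, ← pow_mul, mul_comm n]
  apply mul_dvd_mul_left
  rw [MM, ← Finset.prod_pow, ← Finset.prod_pow]
  apply Finset.prod_dvd_prod_of_dvd
  intro q hq
  rw [← pow_mul, ← pow_mul]
  apply pow_dvd_pow
  have hqp := Nat.prime_of_mem_primeFactors hq
  have h1 : q - 1 ∣ N.totient := by
    rw [← Nat.totient_prime hqp]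
    exact Nat.totient_dvd_of_dvd (Nat.dvd_of_mem_primeFactors hq)
  obtain ⟨c, hc⟩ := h1
  have hpos : 0 < q - 1 := by have := hqp.two_le; omega
  have h2 : N.totient / (q - 1) = c := by rw [hc, Nat.mul_div_cancel_left _ hpos]
  rw [h2, hc]
  calc n / (q - 1) * ((q - 1) * c) = (n / (q - 1) * (q - 1)) * c := by ring
    _ ≤ n * c := Nat.mul_le_mul_right _ (Nat.div_mul_le_self _ _)
    _ = c * n := by ring

lemma den_num_of {a N : ℕ} (hN : N ≠ 0) (h : Nat.gcd a N = 1) :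
    ((a : ℚ) / (N : ℚ)).den = N ∧ ((a : ℚ) / (N : ℚ)).num = a := by
  have h1 : Nat.Coprime (a : ℤ).natAbs (N : ℤ).natAbs := by simpa using h
  have h2 : (0 : ℤ) < N := by omega
  have e1 := Rat.den_div_eq_of_coprime h2 h1
  have e2 := Rat.num_div_eq_of_coprime h2 h1
  simp only [Int.cast_natCast] at e1 e2
  exact ⟨by exact_mod_cast e1, e2⟩

lemma A_dvd (c n : ℕ) (hc : c ≠ 0) (Ψ : Finset ℕ) (hΨ : ∀ b ∈ Ψ, 1 ≤ b) (Z : Finset ℚ)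
    (hZ : ∀ x ∈ Z, ∃ a b : ℕ, b ∈ Ψ ∧ 1 ≤ a ∧ a ≤ c * b ∧
      Nat.gcd a (c * b) = 1 ∧ x = (a : ℚ) / ((c * b : ℕ) : ℚ)) :
    ∏ θ ∈ Z, (θ.den ^ n * MM θ.den n) ∣
      (∏ b ∈ Ψ, (c * b) ^ (c * b).totient) ^ n *
      (∏ b ∈ Ψ, ∏ q ∈ (c * b).primeFactors, q ^ ((c * b).totient / (q - 1))) ^ n := by
  have hmaps : ∀ θ ∈ Z, θ.den ∈ Ψ.image (fun b => c * b) := by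
    intro θ hθ
    obtain ⟨a, b, hb, -, -, hg, rfl⟩ := hZ θ hθ
    have := hΨ b hb
    rw [(den_num_of (by positivity) hg).1]
    exact Finset.mem_image_of_mem _ hb
  rw [← Finset.prod_fiberwise_of_maps_to' hmaps (fun N => N ^ n * MM N n),
    Finset.prod_image (by intro x _ y _ h; exact Nat.eq_of_mul_eq_mul_left (Nat.pos_of_ne_zero hc) h),
    ← Finset.prod_pow, ← Finset.prod_pow, ← Finset.prod_mul_distrib]
  apply Finset.prod_dvd_prod_of_dvd
  intro b hb
  have hb1 := hΨ b hb
  refine dvd_trans ?_ (A_dvd_one (c * b) n)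
  rw [Finset.prod_const]
  apply pow_dvd_pow
  have htot : (c * b).totient = ((Finset.Icc 1 (c * b)).filter (fun a => Nat.gcd a (c * b) = 1)).card := by
    rw [← Nat.filter_coprime_Ico_eq_totient (c * b) 1]
    congr 1
    ext x
    simp only [Finset.mem_filter, Finset.mem_Ico, Finset.mem_Icc, Nat.coprime_comm (n := c * b),
      Nat.coprime_iff_gcd_eq_one]
    omega
  rw [htot]
  apply Finset.card_le_card_of_injOn (fun θ => θ.num.toNat)
  · intro θ hθ
    simp only [Finset.coe_filter, Set.mem_ofPred_eq] at hθ
    obtain ⟨hθZ, hden⟩ := hθ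
    obtain ⟨a, b', hb', h1, h2, hg, rfl⟩ := hZ θ hθZ
    have := hΨ b' hb'
    have hdn := den_num_of (a := a) (N := c * b') (by positivity) hg
    rw [hdn.1] at hden
    simp only [hdn.2, Finset.coe_filter, Set.mem_ofPred_eq, Finset.mem_Icc, Int.toNat_natCast]
    rw [← hden]
    exact ⟨⟨h1, h2⟩, hg⟩
  · intro x hx y hy hxy
    simp only [Finset.coe_filter, Set.mem_ofPred_eq] at hx hy
    have pos : ∀ x ∈ Z, 0 ≤ x.num := by
      intro x hx
      obtain ⟨a, b', hb', h1, h2, hg, rfl⟩ := hZ x hx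
      rw [Rat.num_nonneg]; positivity
    have h1 := pos x hx.1
    have h2 := pos y hy.1
    simp only at hxy
    apply Rat.ext
    · omega
    · rw [hx.2, hy.2]

end aux

open Polynomial
/-- Lemma 5.5: for `θ₀ ∈ 𝒵_B ∖ {θ_min}` and
`ρ_{0,θ₀} = -∑_{i=1}^s ∑_{k=1}^n ∑_{ν=0}^{k-1} r_{i,k}/(ν+θ₀)^i`, the number
`d_n^s · ρ_{0,θ₀}` is an integer. -/
theorem dn_pow_mul_rho_0_theta_int
    (p : ℕ) [Fact p.Prime] (B : ℝ) (Ψ : Finset ℕ)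
    (hΨ : ∀ b : ℕ, b ∈ Ψ ↔ 1 ≤ b ∧ ((p ^ ellp p * b).totient : ℝ) ≤ B)
    (bmax : ℕ) (hbmem : bmax ∈ Ψ) (hbmax : ∀ b ∈ Ψ, b ≤ bmax)
    (Z : Finset ℚ)
    (hZ : ∀ x : ℚ, x ∈ Z ↔ ∃ a b : ℕ, b ∈ Ψ ∧ 1 ≤ a ∧ a ≤ p ^ ellp p * b ∧
      Nat.gcd a (p ^ ellp p * b) = 1 ∧ x = (a : ℚ) / ((p ^ ellp p * b : ℕ) : ℚ))
    (s : ℕ) (hsodd : Odd s) (hscard : Z.card + 1 < s)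
    (n : ℕ) (hnprime : (n + 1).Prime)
    (hndvd : ((Ψ.biUnion fun b => (p ^ ellp p * b).primeFactors).lcm (fun q => q - 1)) *
      p ^ ellp p * bmax ∣ n)
    (hdeg : (2 : ℤ) ≤ ((n : ℤ) + 1) * s - n * ((Z.card : ℤ) - 1) -
      (((p ^ ellp p * bmax - 1) * n / (p ^ ellp p * bmax) : ℕ) : ℤ) + 1)
    (r : ℕ → ℕ → ℚ)
    (hr : ∀ t : ℚ, (∀ j ∈ Finset.range (n + 1), t + (j : ℚ) ≠ 0) →
      Rfun p Ψ Z bmax s n t =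
        ∑ i ∈ Finset.Icc 1 s, ∑ k ∈ Finset.range (n + 1), r i k / (t + (k : ℚ)) ^ i) :
    ∀ θ₀ ∈ Z, θ₀ ≠ 1 / ((p ^ ellp p * bmax : ℕ) : ℚ) →
      ∃ z : ℤ, (dd n : ℚ) ^ s *
        (-∑ i ∈ Finset.Icc 1 s, ∑ k ∈ Finset.Icc 1 n, ∑ ν ∈ Finset.range k,
          r i k / ((ν : ℚ) + θ₀) ^ i) = (z : ℚ) := by
  classical
  have hpp : p.Prime := Fact.out
  have hc1 : 1 < p ^ ellp p := by
    apply Nat.one_lt_pow _ hpp.one_lt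
    unfold ellp; split_ifs <;> norm_num
  have hΨ1 : ∀ b ∈ Ψ, 1 ≤ b := fun b hb => ((hΨ b).1 hb).1
  have hbm1 := hΨ1 bmax hbmem
  set c := p ^ ellp p with hcdef
  have hgt : ∀ b ∈ Ψ, 1 < c * b := fun b hb =>
    lt_of_lt_of_le hc1 (Nat.le_mul_of_pos_right c (hΨ1 b hb))
  -- facts about elements of Z
  have hlt : ∀ θ ∈ Z, 0 < θ ∧ θ < 1 := by
    intro θ hθ
    obtain ⟨a, b, hb, h1, h2, hg, rfl⟩ := (hZ θ).1 hθ
    have hN := hgt b hb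
    have hlt : a < c * b := by
      rcases lt_or_eq_of_le h2 with h | h
      · exact h
      · rw [h, Nat.gcd_self] at hg; omega
    have hNq : (0 : ℚ) < ((c * b : ℕ) : ℚ) := by exact_mod_cast (by omega : 0 < c * b)
    refine ⟨div_pos (by exact_mod_cast h1) hNq, ?_⟩
    rw [div_lt_one hNq]; exact_mod_cast hlt
  have hrefl : ∀ θ ∈ Z, 1 - θ ∈ Z := by
    intro θ hθ
    have hθ1 := hlt θ hθ
    obtain ⟨a, b, hb, h1, h2, hg, rfl⟩ := (hZ θ).1 hθ
    have hN := hgt b hb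
    have hNq : (0 : ℚ) < ((c * b : ℕ) : ℚ) := by exact_mod_cast (by omega : 0 < c * b)
    have h3 := hθ1.2
    rw [div_lt_one hNq] at h3
    have h4 : a < c * b := by exact_mod_cast h3
    refine (hZ _).2 ⟨c * b - a, b, hb, by omega, by omega, ?_, ?_⟩
    · rw [Nat.gcd_comm, Nat.gcd_self_sub_right h2, Nat.gcd_comm]; exact hg
    · rw [Nat.cast_sub h2]; field_simp
  set Nb := c * bmax with hNb
  have hNb1 : 1 < Nb := hgt bmax hbmem
  set θm : ℚ := ((Nb : ℚ) - 1) / (Nb : ℚ) with hθm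
  have hNbq : (Nb : ℚ) ≠ 0 := by exact_mod_cast (by omega : Nb ≠ 0)
  have hθmin : 1 / (Nb : ℚ) ∈ Z := by
    refine (hZ _).2 ⟨1, bmax, hbmem, le_rfl, hNb1.le, by simp, by simp [hNb]⟩
  have hθmZ : θm ∈ Z := by
    have := hrefl _ hθmin
    convert this using 1
    rw [hθm]; field_simp
  set m : ℕ := (Nb - 1) * n / Nb with hm
  have hmn : m - 1 ≤ n := by
    have : m ≤ n := by
      rw [hm]
      apply Nat.div_le_of_le_mul
      exact Nat.mul_le_mul_right _ (by omega)
    omega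
  obtain ⟨w, hw⟩ := A_dvd c n (by omega) Ψ hΨ1 Z (fun x hx => (hZ x).1 hx)
  set A1 : ℕ := ∏ b ∈ Ψ, (c * b) ^ (c * b).totient with hA1
  set A2 : ℕ := ∏ b ∈ Ψ, ∏ q ∈ (c * b).primeFactors, q ^ ((c * b).totient / (q - 1)) with hA2
  have hcard : 1 ≤ Z.card := Finset.card_pos.2 ⟨_, hθmZ⟩
  -- the numerator polynomial
  let F : ℚ[X] := C ((w : ℚ)) *
    ((C ((θm.den : ℚ) ^ n * (MM θm.den n : ℚ)) * (C (1 / ((m - 1).factorial : ℚ)) *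
      ∏ j ∈ Finset.range (m - 1), (X + C (θm + (j : ℚ))))) *
    ∏ θ ∈ Z.erase θm, (C ((θ.den : ℚ) ^ n * (MM θ.den n : ℚ)) * (C (1 / (n.factorial : ℚ)) *
      ∏ j ∈ Finset.range n, (X + C (θ + (j : ℚ))))))
  have hFR : ∀ t : ℚ, (n.factorial : ℚ) ^ s * F.eval t /
      (∏ j ∈ Finset.range (n + 1), (t + (j : ℚ))) ^ s = Rfun p Ψ Z bmax s n t := by
    intro t
    have hw' : (A1 : ℚ) ^ n * (A2 : ℚ) ^ n =
        ((θm.den : ℚ) ^ n * (MM θm.den n : ℚ)) *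
          (∏ θ ∈ Z.erase θm, ((θ.den : ℚ) ^ n * (MM θ.den n : ℚ))) * w := by
      rw [Finset.mul_prod_erase Z (fun θ : ℚ => ((θ.den : ℚ) ^ n * (MM θ.den n : ℚ))) hθmZ]
      exact_mod_cast hw
    have hRf : Rfun p Ψ Z bmax s n t = (A1 : ℚ) ^ n * (A2 : ℚ) ^ n *
        ((Nat.factorial n : ℚ) ^ (s - Z.card + 1) / (Nat.factorial (m - 1) : ℚ)) *
        (∏ j ∈ Finset.range (m - 1), (t + θm + (j : ℚ))) *
        (∏ θ ∈ Z.erase θm, ∏ j ∈ Finset.range n, (t + θ + (j : ℚ))) /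
        (∏ j ∈ Finset.range (n + 1), (t + (j : ℚ))) ^ s := rfl
    rw [hRf, hw']
    congr 1
    have hpw : (n.factorial : ℚ) ^ s = (n.factorial : ℚ) ^ (s - Z.card + 1) *
        (n.factorial : ℚ) ^ (Z.erase θm).card := by
      rw [← pow_add, Finset.card_erase_of_mem hθmZ]; congr 1; omega
    simp only [F, eval_mul, eval_C, eval_pow, eval_prod, eval_add, eval_X, Finset.prod_mul_distrib,
      Finset.prod_const, ← add_assoc]
    rw [hpw]
    have hf0 : (n.factorial : ℚ) ≠ 0 := by positivity
    have hpw2 : (n.factorial : ℚ) ^ (Z.erase θm).card * (1 / (n.factorial : ℚ)) ^ (Z.erase θm).card = 1 := by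
      rw [← mul_pow, mul_one_div_cancel hf0, one_pow]
    linear_combination (((n.factorial : ℚ) ^ (s - Z.card + 1) * w *
      ((θm.den : ℚ) ^ n * (MM θm.den n : ℚ)) * (1 / ((m - 1).factorial : ℚ)) *
      (∏ j ∈ Finset.range (m - 1), (t + θm + (j : ℚ))) *
      (∏ θ ∈ Z.erase θm, (θ.den : ℚ) ^ n) * (∏ θ ∈ Z.erase θm, (MM θ.den n : ℚ)) *
      (∏ θ ∈ Z.erase θm, ∏ j ∈ Finset.range n, (t + θ + (j : ℚ))))) * hpw2
  have hFL : ∀ k : ℕ, F.comp (C (dd n : ℚ) * X - C (k : ℚ)) ∈ LL := by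
    intro k
    have hblock : ∀ (θ : ℚ) (r : ℕ), r ≤ n →
        C ((θ.den : ℚ) ^ n * (MM θ.den n : ℚ)) * (C (1 / (r.factorial : ℚ)) *
          ∏ j ∈ Finset.range r, (C (dd n : ℚ) * X - C (k : ℚ) + C (θ + (j : ℚ)))) ∈ LL := by
      intro θ r hrn
      have h := asc_block (n := n) θ.den_nz θ.num k hrn
      rw [Rat.num_div_den] at h
      convert h using 3
      apply Finset.prod_congr rfl
      intro j _
      simp only [C_add, C_sub]; ring
    simp only [F, mul_comp, C_comp, prod_comp, add_comp, X_comp]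
    exact mul_mem (C_int_mem ⟨w, by simp⟩) (mul_mem (hblock _ _ hmn)
      (prod_mem fun θ _ => hblock θ n le_rfl))
  have hrint : ∀ i ∈ Finset.Icc 1 s, ∀ k ≤ n, ∃ z : ℤ, (dd n : ℚ) ^ (s - i) * r i k = z := by
    intro i hi k hk
    exact partial_int n s F r k hk (fun t ht => (hFR t).trans (hr t ht)) (hFL k) i hi
  intro θ₀ hθ₀ hne
  have hθ01 := hlt θ₀ hθ₀
  have hzero : ∀ l ∈ Finset.Icc 1 n,
      ∑ i ∈ Finset.Icc 1 s, ∑ k ∈ Finset.range (n + 1), r i k / (θ₀ - l + k) ^ i = 0 := by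
    intro l hl
    rw [Finset.mem_Icc] at hl
    rw [← hr (θ₀ - l), ← hFR]
    · have : F.eval (θ₀ - l) = 0 := by
        simp only [F, eval_mul, eval_C, eval_prod, eval_add, eval_X]
        apply mul_eq_zero_of_right
        apply mul_eq_zero_of_right
        apply Finset.prod_eq_zero (i := 1 - θ₀)
        · rw [Finset.mem_erase]
          refine ⟨?_, hrefl _ hθ₀⟩
          intro h
          apply hne
          rw [hθm, sub_div, div_self hNbq] at h
          linarith
        · apply mul_eq_zero_of_right
          apply mul_eq_zero_of_right
          apply Finset.prod_eq_zero (i := l - 1)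
          · rw [Finset.mem_range]; omega
          · rw [Nat.cast_sub hl.1]; push_cast; ring
      rw [this]; simp
    · intro j _ h
      have h1 : θ₀ = ((l - j : ℤ) : ℚ) := by push_cast; linarith
      rw [h1] at hθ01
      have h2 : (0 : ℤ) < l - j := by exact_mod_cast hθ01.1
      have h3 : (l - j : ℤ) < 1 := by exact_mod_cast hθ01.2
      omega
  have hslice : ∀ l ∈ Finset.Icc 1 n, ∃ z : ℤ, (dd n : ℚ) ^ s *
      ∑ i ∈ Finset.Icc 1 s, ∑ k ∈ Finset.Icc l n, r i k / (θ₀ - l + k) ^ i = z :=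
    fun l hl => slice_int n s r θ₀ hrint l (hzero l hl)
  have hre : ∑ i ∈ Finset.Icc 1 s, ∑ k ∈ Finset.Icc 1 n, ∑ ν ∈ Finset.range k,
      r i k / ((ν : ℚ) + θ₀) ^ i =
      ∑ l ∈ Finset.Icc 1 n, ∑ i ∈ Finset.Icc 1 s, ∑ k ∈ Finset.Icc l n,
        r i k / (θ₀ - l + k) ^ i := by
    rw [Finset.sum_comm]
    rw [Finset.sum_comm]
    rw [Finset.sum_comm (s := Finset.Icc 1 n)]
    apply Finset.sum_congr rfl
    intro i _
    rw [sum_reindex n (fun k ν => r i k / ((ν : ℚ) + θ₀) ^ i)]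
    apply Finset.sum_congr rfl
    intro l _
    apply Finset.sum_congr rfl
    intro k hk
    rw [Finset.mem_Icc] at hk
    rw [Nat.cast_sub hk.1]
    congr 2; ring
  have hmem : (dd n : ℚ) ^ s * (-∑ i ∈ Finset.Icc 1 s, ∑ k ∈ Finset.Icc 1 n, ∑ ν ∈ Finset.range k,
      r i k / ((ν : ℚ) + θ₀) ^ i) ∈ (Int.castRingHom ℚ).range := by
    rw [hre, mul_neg, Finset.mul_sum]
    apply neg_mem
    apply sum_mem
    intro l hl
    obtain ⟨z, hz⟩ := hslice l hl
    exact ⟨z, by rw [hz]; simp⟩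
  obtain ⟨z, hz⟩ := hmem
  exact ⟨z, by rw [← hz]; simp⟩
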